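/- Let t₀ ≥ 1, A, x₀ ∈ ℝ, ν ∈ [0,1), and let α, β : [t₀,∞) → ℝ be continuous with α(t) ≤ β(t) for all t ≥ t₀ and α(t) = o(t^{−ν}), β(t) = o(t^{−ν}) as t → ∞. Let f : [t₀,∞) × ℝ → ℝ be continuous with α(t) ≤ ∫_t^∞ f(s,u(s)) ds ≤ β(t) for every u ∈ E_{A,x₀} and t ≥ t₀, and |f(t,u₂(t)) − f(t,u₁(t))| ≤ (k(t)/t)·|u₂(t) − u₁(t)| for all u₁,u₂ ∈ E_{A,x₀} and t ≥ t₀, where k : [t₀,∞) → [0,∞) is continuous with ϖ := (1/(1−ν))·∫_{t₀}^∞ k(t) dt < 1. Then the boundary value problem x''(t) + f(t,x(t)) = 0 on [t₀,∞), x(t₀) = x₀, x(t) = A·t + o(t^{1−ν}) as t → ∞, has a unique solution x with the property that α(t) ≤ x'(t) − A ≤ β(t) for all t ≥ t₀. In particular, if ∫_{t₀}^∞ α(t) dt = +∞ then lim_{t→∞} [x(t) − A·t] = +∞. -/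

import Mathlib

open Real MeasureTheory Filter Topology Set Asymptotics

/-- Membership in `E_{A,x₀}`: `u` is continuously differentiable on `[t₀,∞)` with
derivative `u'`, `u(t₀) = x₀` and `α(t) ≤ u'(t) - A ≤ β(t)`. -/
def memE (t₀ A x₀ : ℝ) (α β : ℝ → ℝ) (u u' : ℝ → ℝ) : Prop :=
  (∀ t ∈ Set.Ici t₀, HasDerivAt u (u' t) t) ∧ ContinuousOn u' (Set.Ici t₀) ∧
    u t₀ = x₀ ∧ ∀ t ∈ Set.Ici t₀, α t ≤ u' t - A ∧ u' t - A ≤ β t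

/-- If `|h'| ≤ d * t ^ (-ν)` on `[a, ∞)`, integrating gives a bound of order `t ^ (1 - ν)`. -/
theorem abs_le_add_rpow_of_abs_deriv_le {a d ν : ℝ} {h h' : ℝ → ℝ} (ha : 0 < a) (hν : ν < 1)
    (hd : 0 ≤ d) (hh : ∀ t ∈ Ici a, HasDerivAt h (h' t) t)
    (hb : ∀ t ∈ Ici a, |h' t| ≤ d * t ^ (-ν)) {t : ℝ} (ht : t ∈ Ici a) :
    |h t| ≤ |h a| + d / (1 - ν) * t ^ (1 - ν) := by
  have hν' : 0 < 1 - ν := sub_pos.2 hν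
  have hB : ∀ s ∈ Ici a, HasDerivAt (fun s => |h a| + d / (1 - ν) * s ^ (1 - ν))
      (d * s ^ (-ν)) s := by
    intro s hs
    have hs0 : s ≠ 0 := (ha.trans_le hs).ne'
    refine (((hasDerivAt_rpow_const (p := 1 - ν) (Or.inl hs0)).const_mul
      (d / (1 - ν))).const_add |h a|).congr_deriv ?_
    rw [show 1 - ν - 1 = -ν by ring]
    field_simp
  refine image_norm_le_of_norm_deriv_right_le_deriv_boundary' (f := h) (f' := h')
    (a := a) (b := t) (B := fun s => |h a| + d / (1 - ν) * s ^ (1 - ν))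
    (B' := fun s => d * s ^ (-ν))
    (fun s hs => (hh s hs.1).continuousAt.continuousWithinAt)
    (fun s hs => (hh s hs.1).hasDerivWithinAt) ?_
    (fun s hs => (hB s hs.1).continuousAt.continuousWithinAt)
    (fun s hs => (hB s hs.1).hasDerivWithinAt) (fun s hs => hb s hs.1) ⟨ht, le_rfl⟩
  have : 0 ≤ d / (1 - ν) * a ^ (1 - ν) := by positivity
  simpa using this

/-- Integration of a little-o bound on the derivative. -/
theorem isLittleO_rpow_of_isLittleO_deriv {a ν : ℝ} {h h' : ℝ → ℝ} (ha : 0 < a) (hν : ν < 1)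
    (hh : ∀ t ∈ Ici a, HasDerivAt h (h' t) t) (ho : h' =o[atTop] fun t : ℝ => t ^ (-ν)) :
    h =o[atTop] fun t : ℝ => t ^ (1 - ν) := by
  have hν' : 0 < 1 - ν := sub_pos.2 hν
  refine isLittleO_iff.2 fun c hc => ?_
  have hc' : 0 < c / 2 * (1 - ν) := by positivity
  obtain ⟨T, hT⟩ := eventually_atTop.1 (isLittleO_iff.1 ho hc')
  have hconst := ((tendsto_rpow_atTop hν').const_mul_atTop (half_pos hc)).eventually_ge_atTop
    |h (max a T)|
  filter_upwards [hconst, eventually_ge_atTop (max a T)] with t ht1 ht2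
  have ht0 : 0 < t := ha.trans_le ((le_max_left _ _).trans ht2)
  have := abs_le_add_rpow_of_abs_deriv_le (h := h) (h' := h') (a := max a T)
    (lt_max_of_lt_left ha) hν hc'.le
    (fun s hs => hh s ((le_max_left a T).trans (mem_Ici.1 hs))) (fun s hs => by
      have hs0 : 0 < s := ha.trans_le ((le_max_left a T).trans (mem_Ici.1 hs))
      simpa [abs_of_pos (rpow_pos_of_pos hs0 (-ν))] using hT s ((le_max_right a T).trans (mem_Ici.1 hs))) ht2
  rw [mul_div_assoc, div_self hν'.ne', mul_one] at this
  rw [norm_eq_abs, norm_eq_abs, abs_of_pos (rpow_pos_of_pos ht0 _)]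
  linarith

/-- A continuous function on `[a, ∞)` that is `o(t ^ (-ν))` is bounded by a multiple of
`t ^ (-ν)`. -/
theorem exists_abs_le_mul_rpow_of_isLittleO {a ν : ℝ} {g : ℝ → ℝ} (ha : 0 < a)
    (hg : ContinuousOn g (Ici a)) (ho : g =o[atTop] fun t : ℝ => t ^ (-ν)) :
    ∃ M, 0 ≤ M ∧ ∀ t ∈ Ici a, |g t| ≤ M * t ^ (-ν) := by
  obtain ⟨T, hT⟩ := eventually_atTop.1 (isLittleO_iff.1 ho one_pos)
  have hpos : ∀ t ∈ Ici a, 0 < t ^ (-ν) := fun t ht => rpow_pos_of_pos (ha.trans_le ht) _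
  have hq : ContinuousOn (fun t => g t / t ^ (-ν)) (Icc a T) :=
    (hg.mono Icc_subset_Ici_self).div
      (continuousOn_id.rpow_const fun t ht => Or.inl (ha.trans_le ht.1).ne')
      fun t ht => (hpos t ht.1).ne'
  obtain ⟨C, hC⟩ := isCompact_Icc.exists_bound_of_continuousOn hq
  refine ⟨max C 1, zero_le_one.trans (le_max_right _ _), fun t ht => ?_⟩
  have hp := hpos t ht
  rcases le_total t T with h | h
  · have := hC t ⟨ht, h⟩
    rw [norm_eq_abs, abs_div, abs_of_pos hp, div_le_iff₀ hp] at this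
    exact this.trans (by gcongr; exact le_max_left _ _)
  · have := hT t h
    rw [norm_eq_abs, norm_eq_abs, abs_of_pos hp] at this
    exact this.trans (by gcongr; exact le_max_right _ _)

/-- The tail integral of a continuous integrable function on `[a, ∞)` extends to a continuous
function on `ℝ`, differentiable (on both sides) at every point of `[a, ∞)`. -/
theorem exists_hasDerivAt_tail_integral {a : ℝ} {g : ℝ → ℝ} (hc : ContinuousOn g (Ici a))
    (hi : IntegrableOn g (Ici a)) :
    ∃ G : ℝ → ℝ, Continuous G ∧ Tendsto G atTop (𝓝 0) ∧
      ∀ t ∈ Ici a, G t = (∫ s in Ioi t, g s) ∧ HasDerivAt G (-g t) t := by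
  have hcont : Continuous fun s => g (max s a) :=
    hc.comp_continuous (continuous_id.max continuous_const) fun s => le_max_right s a
  have hint : ∀ t ∈ Ici a, ∫ s in a..t, g (max s a) = ∫ s in a..t, g s := by
    intro t ht
    refine intervalIntegral.integral_congr fun s hs => ?_
    rw [uIcc_of_le ht] at hs
    simp only [max_eq_left hs.1]
  have hia : IntegrableOn g (Ioi a) := hi.mono_set Ioi_subset_Ici_self
  have hderiv : ∀ t, HasDerivAt (fun t => (∫ s in Ioi a, g s) - ∫ s in a..t, g (max s a))
      (-g (max t a)) t := fun t =>
    (hcont.integral_hasStrictDerivAt a t).hasDerivAt.const_sub _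
  refine ⟨fun t => (∫ s in Ioi a, g s) - ∫ s in a..t, g (max s a),
    continuous_iff_continuousAt.2 fun t => (hderiv t).continuousAt, ?_, fun t ht => ⟨?_, ?_⟩⟩
  · have h := (intervalIntegral_tendsto_integral_Ioi a hia tendsto_id).const_sub
      (∫ s in Ioi a, g s)
    rw [sub_self] at h
    refine h.congr' ?_
    filter_upwards [eventually_ge_atTop a] with t ht
    rw [hint t ht, id]
  · simp only [hint t ht]
    rw [← intervalIntegral.integral_interval_add_Ioi hia (hia.mono_set (Ioi_subset_Ioi ht))]
    ring
  · have := hderiv t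
    rwa [max_eq_left (show a ≤ t from ht)] at this

/-- The contraction estimate for tail integrals in the weighted norm `sup t ^ ν * |h' t|`. -/
theorem abs_tail_integral_sub_le {a d ν : ℝ} {h h' k g₁ g₂ : ℝ → ℝ} (ha : 0 < a) (hν0 : 0 ≤ ν)
    (hν : ν < 1) (hd : 0 ≤ d) (hh : ∀ t ∈ Ici a, HasDerivAt h (h' t) t) (hha : h a = 0)
    (hb : ∀ t ∈ Ici a, |h' t| ≤ d * t ^ (-ν))
    (hk_nonneg : ∀ t ∈ Ici a, 0 ≤ k t) (hk_int : IntegrableOn k (Ici a))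
    (hg₁ : IntegrableOn g₁ (Ici a)) (hg₂ : IntegrableOn g₂ (Ici a))
    (hg : ∀ t ∈ Ici a, |g₂ t - g₁ t| ≤ k t / t * |h t|) {t : ℝ} (ht : t ∈ Ici a) :
    |(∫ s in Ioi t, g₂ s) - ∫ s in Ioi t, g₁ s| ≤
      (1 / (1 - ν) * ∫ s in Ici a, k s) * d * t ^ (-ν) := by
  have hν' : 0 < 1 - ν := sub_pos.2 hν
  have ht0 : 0 < t := ha.trans_le ht
  have hsub : Ioi t ⊆ Ici a := fun s hs => (show a ≤ t from ht).trans (le_of_lt hs)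
  rw [← integral_sub (hg₂.mono_set hsub) (hg₁.mono_set hsub)]
  have hle : ∀ s ∈ Ioi t, ‖g₂ s - g₁ s‖ ≤ k s * (d / (1 - ν) * t ^ (-ν)) := by
    intro s hs
    have hsa := hsub hs
    have hs0 : 0 < s := ht0.trans hs
    have h1 := abs_le_add_rpow_of_abs_deriv_le ha hν hd hh hb hsa
    rw [hha, abs_zero, zero_add] at h1
    have h2 : s ^ (-ν) ≤ t ^ (-ν) :=
      rpow_le_rpow_of_nonpos ht0 (le_of_lt hs) (neg_nonpos.2 hν0)
    have h3 : s ^ (1 - ν) = s * s ^ (-ν) := by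
      rw [sub_eq_add_neg, rpow_add hs0, rpow_one]
    have hk0 := hk_nonneg s hsa
    calc ‖g₂ s - g₁ s‖ ≤ k s / s * |h s| := hg s hsa
      _ ≤ k s / s * (d / (1 - ν) * s ^ (1 - ν)) := by gcongr
      _ = k s * (d / (1 - ν) * s ^ (-ν)) := by rw [h3]; field_simp
      _ ≤ k s * (d / (1 - ν) * t ^ (-ν)) := by gcongr
  have hkt : IntegrableOn k (Ioi t) := hk_int.mono_set hsub
  have h4 := norm_integral_le_of_norm_le (hkt.mul_const (d / (1 - ν) * t ^ (-ν)))
    (ae_restrict_of_forall_mem measurableSet_Ioi hle)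
  rw [integral_mul_const] at h4
  have h5 : ∫ s in Ioi t, k s ≤ ∫ s in Ici a, k s :=
    setIntegral_mono_set hk_int (ae_restrict_of_forall_mem measurableSet_Ici hk_nonneg)
      hsub.eventuallyLE
  calc _ ≤ (∫ s in Ioi t, k s) * (d / (1 - ν) * t ^ (-ν)) := h4
    _ ≤ (∫ s in Ici a, k s) * (d / (1 - ν) * t ^ (-ν)) := by gcongr
    _ = _ := by ring

/-- A function with derivative `-g` on `[a, ∞)` that tends to `A` is `A` plus the tail integral
of `g`. -/
theorem eq_add_tail_integral_of_tendsto {a A : ℝ} {g v : ℝ → ℝ} (hc : ContinuousOn g (Ici a))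
    (hi : IntegrableOn g (Ici a)) (hv : ∀ t ∈ Ici a, HasDerivAt v (-g t) t)
    (hlim : Tendsto v atTop (𝓝 A)) {t : ℝ} (ht : t ∈ Ici a) :
    v t = A + ∫ s in Ioi t, g s := by
  obtain ⟨G, -, hG0, hG⟩ := exists_hasDerivAt_tail_integral hc hi
  have hder : ∀ s ∈ Ici a, HasDerivAt (fun s => v s - G s) 0 s := fun s hs => by
    simpa using (hv s hs).fun_sub (hG s hs).2
  have hconst : ∀ s ∈ Ici a, v s - G s = v a - G a := fun s hs =>
    constant_of_has_deriv_right_zero (f := fun s => v s - G s) (b := s)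
      (fun r hr => (hder r hr.1).continuousAt.continuousWithinAt)
      (fun r hr => (hder r hr.1).hasDerivWithinAt) s ⟨hs, le_rfl⟩
  have h1 : Tendsto (fun s => v s - G s) atTop (𝓝 (v a - G a)) :=
    tendsto_const_nhds.congr' <| by
      filter_upwards [eventually_ge_atTop a] with s hs using (hconst s hs).symm
  have h2 := tendsto_nhds_unique h1 (hlim.sub hG0)
  have h3 := hconst t ht
  rw [← (hG t ht).1]
  linarith

/-- The boundary value problem `x'' + f(t,x) = 0`, `x(t₀) = x₀`,
`x(t) = A·t + o(t^{1-ν})`, has a unique solution `x` with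
`α(t) ≤ x'(t) - A ≤ β(t)`; if moreover `∫_{t₀}^∞ α = +∞`, then `x(t) - A·t → +∞`. -/
theorem stmt_9 (t₀ A x₀ ν : ℝ) (ht₀ : 1 ≤ t₀) (hν0 : 0 ≤ ν) (hν1 : ν < 1)
    (α β : ℝ → ℝ)
    (hα_cont : ContinuousOn α (Set.Ici t₀)) (hβ_cont : ContinuousOn β (Set.Ici t₀))
    (hαβ : ∀ t ∈ Set.Ici t₀, α t ≤ β t)
    (hα_o : α =o[atTop] fun t : ℝ => t ^ (-ν))
    (hβ_o : β =o[atTop] fun t : ℝ => t ^ (-ν))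
    (f : ℝ → ℝ → ℝ)
    (hf_cont : ContinuousOn (fun p : ℝ × ℝ => f p.1 p.2) (Set.Ici t₀ ×ˢ Set.univ))
    (hcond : ∀ u u' : ℝ → ℝ, memE t₀ A x₀ α β u u' →
      IntegrableOn (fun s => f s (u s)) (Set.Ici t₀) ∧
      ∀ t ∈ Set.Ici t₀, α t ≤ (∫ s in Set.Ioi t, f s (u s)) ∧
        (∫ s in Set.Ioi t, f s (u s)) ≤ β t)
    (k : ℝ → ℝ) (hk_cont : ContinuousOn k (Set.Ici t₀))
    (hk_nonneg : ∀ t ∈ Set.Ici t₀, 0 ≤ k t)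
    (hk_int : IntegrableOn k (Set.Ici t₀))
    (hϖ : 1 / (1 - ν) * (∫ t in Set.Ici t₀, k t) < 1)
    (hlip : ∀ u₁ u₁' u₂ u₂' : ℝ → ℝ,
      memE t₀ A x₀ α β u₁ u₁' → memE t₀ A x₀ α β u₂ u₂' → ∀ t ∈ Set.Ici t₀,
      |f t (u₂ t) - f t (u₁ t)| ≤ k t / t * |u₂ t - u₁ t|) :
    ∃ x x' : ℝ → ℝ,
      ((∀ t ∈ Set.Ici t₀, HasDerivAt x (x' t) t ∧ HasDerivAt x' (-f t (x t)) t) ∧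
        x t₀ = x₀ ∧
        ((fun t => x t - A * t) =o[atTop] fun t : ℝ => t ^ (1 - ν)) ∧
        ∀ t ∈ Set.Ici t₀, α t ≤ x' t - A ∧ x' t - A ≤ β t) ∧
      (∀ y y' : ℝ → ℝ,
        ((∀ t ∈ Set.Ici t₀, HasDerivAt y (y' t) t ∧ HasDerivAt y' (-f t (y t)) t) ∧
          y t₀ = x₀ ∧
          ((fun t => y t - A * t) =o[atTop] fun t : ℝ => t ^ (1 - ν)) ∧
          ∀ t ∈ Set.Ici t₀, α t ≤ y' t - A ∧ y' t - A ≤ β t) →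
        ∀ t ∈ Set.Ici t₀, y t = x t) ∧
      (Tendsto (fun T => ∫ t in t₀..T, α t) atTop atTop →
        Tendsto (fun t => x t - A * t) atTop atTop) := by
  have ha : 0 < t₀ := one_pos.trans_le ht₀
  have hν' : 0 < 1 - ν := sub_pos.2 hν1
  obtain ⟨Mα, hMα0, hMα⟩ := exists_abs_le_mul_rpow_of_isLittleO ha hα_cont hα_o
  obtain ⟨Mβ, hMβ0, hMβ⟩ := exists_abs_le_mul_rpow_of_isLittleO ha hβ_cont hβ_o
  set ϖ := 1 / (1 - ν) * ∫ t in Ici t₀, k t with hϖ_def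
  have hϖ0 : 0 ≤ ϖ :=
    mul_nonneg (by positivity) (setIntegral_nonneg measurableSet_Ici hk_nonneg)
  have hM : ∀ c t, t ∈ Ici t₀ → α t ≤ c → c ≤ β t → |c| ≤ (Mα + Mβ) * t ^ (-ν) := by
    intro c t ht h1 h2
    have h3 := abs_le.1 (hMα t ht)
    have h4 := abs_le.1 (hMβ t ht)
    have h5 : 0 ≤ t ^ (-ν) := rpow_nonneg (ha.trans_le ht).le _
    have h6 := mul_nonneg hMα0 h5
    have h7 := mul_nonneg hMβ0 h5
    rw [abs_le, add_mul]
    constructor <;> linarith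
  have hcontf : ∀ u u', memE t₀ A x₀ α β u u' → ContinuousOn (fun s => f s (u s)) (Ici t₀) :=
    fun u u' hu => hf_cont.comp (f := fun s => (s, u s))
      (continuousOn_id.prodMk fun s hs => (hu.1 s hs).continuousAt.continuousWithinAt)
      fun s hs => ⟨hs, mem_univ _⟩
  have hstep : ∀ u₁ u₁' u₂ u₂' d, memE t₀ A x₀ α β u₁ u₁' → memE t₀ A x₀ α β u₂ u₂' → 0 ≤ d →
      (∀ t ∈ Ici t₀, |u₂' t - u₁' t| ≤ d * t ^ (-ν)) → ∀ t ∈ Ici t₀,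
      |(∫ s in Ioi t, f s (u₂ s)) - ∫ s in Ioi t, f s (u₁ s)| ≤ ϖ * d * t ^ (-ν) :=
    fun u₁ u₁' u₂ u₂' d h₁ h₂ hd hb t ht =>
      abs_tail_integral_sub_le (h := fun t => u₂ t - u₁ t) ha hν0 hν1 hd
        (fun t ht => (h₂.1 t ht).sub (h₁.1 t ht)) (by simp [h₁.2.2.1, h₂.2.2.1]) hb hk_nonneg
        hk_int (hcond _ _ h₁).1 (hcond _ _ h₂).1 (hlip _ _ _ _ h₁ h₂) ht
  have hlim : ∀ u u', memE t₀ A x₀ α β u u' →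
      (fun t => u' t - A) =o[atTop] fun t : ℝ => t ^ (-ν) := by
    intro u u' hu
    refine isLittleO_iff.2 fun c hc => ?_
    filter_upwards [isLittleO_iff.1 hα_o hc, isLittleO_iff.1 hβ_o hc,
      eventually_ge_atTop t₀] with t h1 h2 ht
    have h3 := hu.2.2.2 t ht
    exact abs_le.2 ⟨(abs_le.1 h1).1.trans h3.1, h3.2.trans (abs_le.1 h2).2⟩
  have hlim0 : ∀ u u', memE t₀ A x₀ α β u u' → Tendsto u' atTop (𝓝 A) := by
    intro u u' hu
    have hO : (fun t : ℝ => t ^ (-ν)) =O[atTop] fun _ => (1 : ℝ) := by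
      refine IsBigO.of_bound 1 ?_
      filter_upwards [eventually_ge_atTop 1] with t ht
      rw [norm_eq_abs, abs_of_nonneg (rpow_nonneg (zero_le_one.trans ht) _)]
      simpa using rpow_le_one_of_one_le_of_nonpos ht (neg_nonpos.2 hν0)
    have := (isLittleO_one_iff ℝ).1 ((hlim u u' hu).trans_isBigO hO)
    simpa using this.add_const A
  -- weighted derivatives `t ^ ν * (u' t - A)` of the members of `E`
  let p : ℝ → ℝ := fun t => (max t t₀) ^ ν
  have hmax : ∀ t, 0 < max t t₀ := fun t => lt_max_of_lt_right ha
  have hp0 : ∀ t, 0 < p t := fun t => rpow_pos_of_pos (hmax t) _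
  have hp_cont : Continuous p :=
    (continuous_id.max continuous_const).rpow_const fun t => Or.inl (hmax t).ne'
  have hp : ∀ t, p t * (max t t₀) ^ (-ν) = 1 := fun t => by
    rw [rpow_neg (hmax t).le, mul_inv_cancel₀ (hp0 t).ne']
  have hpt : ∀ t ∈ Ici t₀, (p t)⁻¹ = t ^ (-ν) := fun t ht => by
    rw [rpow_neg (ha.trans_le ht).le, show p t = t ^ ν by simp only [p, max_eq_left (mem_Ici.1 ht)]]
  let S : Set (BoundedContinuousFunction ℝ ℝ) :=
    {w | ∀ t ∈ Ici t₀, α t ≤ w t / p t ∧ w t / p t ≤ β t}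
  have hS : IsClosed S := by
    have : S = ⋂ t ∈ Ici t₀, {w | α t ≤ w t / p t} ∩ {w | w t / p t ≤ β t} := by
      ext w
      simp [S]
    rw [this]
    refine isClosed_biInter fun t _ => IsClosed.inter ?_ ?_
    · exact isClosed_le continuous_const ((continuous_eval_const t).div_const _)
    · exact isClosed_le ((continuous_eval_const t).div_const _) continuous_const
  have hlift : ∀ g : ℝ → ℝ, ContinuousOn g (Ici t₀) →
      (∀ t ∈ Ici t₀, α t ≤ g t ∧ g t ≤ β t) →
      ∃ w : BoundedContinuousFunction ℝ ℝ, w ∈ S ∧ ∀ t, w t = p t * g (max t t₀) := by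
    intro g hg hgb
    have hgc : Continuous fun t => g (max t t₀) :=
      hg.comp_continuous (continuous_id.max continuous_const) fun t => le_max_right t t₀
    refine ⟨BoundedContinuousFunction.ofNormedAddCommGroup (fun t => p t * g (max t t₀))
      (hp_cont.mul hgc) (Mα + Mβ) fun t => ?_, fun t ht => ?_, fun t => rfl⟩
    · have hm : max t t₀ ∈ Ici t₀ := le_max_right t t₀
      rw [norm_eq_abs, abs_mul, abs_of_pos (hp0 t)]
      calc p t * |g (max t t₀)| ≤ p t * ((Mα + Mβ) * (max t t₀) ^ (-ν)) :=
            mul_le_mul_of_nonneg_left (hM _ _ hm (hgb _ hm).1 (hgb _ hm).2) (hp0 t).le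
        _ = (Mα + Mβ) * (p t * (max t t₀) ^ (-ν)) := by ring
        _ = Mα + Mβ := by rw [hp, mul_one]
    · change α t ≤ p t * g (max t t₀) / p t ∧ p t * g (max t t₀) / p t ≤ β t
      rw [mul_div_cancel_left₀ _ (hp0 t).ne', max_eq_left (mem_Ici.1 ht)]
      exact hgb t ht
  let U : BoundedContinuousFunction ℝ ℝ → ℝ → ℝ := fun w t => x₀ + ∫ s in t₀..t, (A + w s / p s)
  have hU : ∀ w ∈ S, memE t₀ A x₀ α β (U w) fun t => A + w t / p t := by
    intro w hw
    have hc : Continuous fun t => A + w t / p t :=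
      continuous_const.add (w.continuous.div hp_cont fun t => (hp0 t).ne')
    refine ⟨fun t _ => ((hc.integral_hasStrictDerivAt t₀ t).hasDerivAt).const_add x₀,
      hc.continuousOn, by simp [U], fun t ht => ?_⟩
    simpa using hw t ht
  have hT : ∀ w : S, ∃ w' : S, ∀ t,
      w'.1 t = p t * ∫ s in Ioi (max t t₀), f s (U w.1 s) := by
    intro w
    have hu := hU w.1 w.2
    obtain ⟨hi, hb⟩ := hcond _ _ hu
    obtain ⟨G, hGc, -, hG⟩ := exists_hasDerivAt_tail_integral (hcontf _ _ hu) hi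
    obtain ⟨w', hw', hw't⟩ := hlift G hGc.continuousOn fun t ht => by
      rw [(hG t ht).1]
      exact hb t ht
    exact ⟨⟨w', hw'⟩, fun t => by rw [hw't, (hG _ (le_max_right t t₀)).1]⟩
  choose T hT using hT
  have hcontr : ContractingWith ⟨ϖ, hϖ0⟩ T := by
    refine ⟨hϖ, LipschitzWith.of_dist_le_mul fun w₁ w₂ => ?_⟩
    refine (BoundedContinuousFunction.dist_le (mul_nonneg hϖ0 dist_nonneg)).2 fun t => ?_
    have h := hstep _ _ _ _ (dist w₁ w₂) (hU w₂.1 w₂.2) (hU w₁.1 w₁.2) dist_nonneg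
      (fun s hs => by
        have h1 : |w₁.1 s - w₂.1 s| ≤ dist w₁ w₂ :=
          BoundedContinuousFunction.dist_coe_le_dist (f := w₁.1) (g := w₂.1) s
        have h2 : A + w₁.1 s / p s - (A + w₂.1 s / p s) = (w₁.1 s - w₂.1 s) * (p s)⁻¹ := by
          ring
        rw [h2, abs_mul, abs_of_pos (inv_pos.2 (hp0 s)), ← hpt s hs]
        exact mul_le_mul_of_nonneg_right h1 (inv_pos.2 (hp0 s)).le)
      (max t t₀) (le_max_right t t₀)
    rw [Real.dist_eq, hT, hT, ← mul_sub, abs_mul, abs_of_pos (hp0 t)]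
    calc _ ≤ p t * (ϖ * dist w₁ w₂ * (max t t₀) ^ (-ν)) :=
          mul_le_mul_of_nonneg_left h (hp0 t).le
      _ = ϖ * dist w₁ w₂ * (p t * (max t t₀) ^ (-ν)) := by ring
      _ = ϖ * dist w₁ w₂ := by rw [hp, mul_one]
  have : CompleteSpace S := hS.completeSpace_coe
  have : Nonempty S := by
    obtain ⟨w, hw, -⟩ := hlift α hα_cont fun t ht => ⟨le_rfl, hαβ t ht⟩
    exact ⟨⟨w, hw⟩⟩
  obtain ⟨w, hw⟩ : ∃ w, T w = w := ⟨_, hcontr.fixedPoint_isFixedPt⟩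
  have hu := hU w.1 w.2
  obtain ⟨hi, hb⟩ := hcond _ _ hu
  obtain ⟨G, hGc, -, hG⟩ := exists_hasDerivAt_tail_integral (hcontf _ _ hu) hi
  have hwG : ∀ t ∈ Ici t₀, w.1 t / p t = G t := fun t ht => by
    have h := hT w t
    rw [hw, max_eq_left (mem_Ici.1 ht)] at h
    rw [h, mul_div_cancel_left₀ _ (hp0 t).ne', (hG t ht).1]
  let x : ℝ → ℝ := fun t => x₀ + ∫ s in t₀..t, (A + G s)
  have hxU : ∀ t ∈ Ici t₀, U w.1 t = x t := fun t ht => by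
    refine congrArg (x₀ + ·) (intervalIntegral.integral_congr fun s hs => ?_)
    rw [uIcc_of_le ht] at hs
    exact congrArg (A + ·) (hwG s hs.1)
  have hx : memE t₀ A x₀ α β x fun t => A + G t := by
    have hc : Continuous fun t => A + G t := continuous_const.add hGc
    refine ⟨fun t _ => ((hc.integral_hasStrictDerivAt t₀ t).hasDerivAt).const_add x₀,
      hc.continuousOn, by simp [x], fun t ht => ?_⟩
    simpa [(hG t ht).1] using hb t ht
  have hode : ∀ t ∈ Ici t₀, HasDerivAt (fun t => A + G t) (-f t (x t)) t := fun t ht => by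
    rw [← hxU t ht]
    exact (hG t ht).2.const_add A
  have hdiff : ∀ t ∈ Ici t₀, HasDerivAt (fun t => x t - A * t) (A + G t - A) t := fun t ht =>
    (hx.1 t ht).sub (by simpa using (hasDerivAt_id t).const_mul A)
  refine ⟨x, fun t => A + G t, ⟨fun t ht => ⟨hx.1 t ht, hode t ht⟩, hx.2.2.1,
    isLittleO_rpow_of_isLittleO_deriv ha hν1 hdiff (hlim _ _ hx), hx.2.2.2⟩, ?_, ?_⟩
  · rintro y y' ⟨hy, hy0, -, hyb⟩ t ht
    have hyE : memE t₀ A x₀ α β y y' :=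
      ⟨fun t ht => (hy t ht).1, fun t ht => (hy t ht).2.continuousAt.continuousWithinAt, hy0, hyb⟩
    have hrep : ∀ u u', memE t₀ A x₀ α β u u' →
        (∀ t ∈ Ici t₀, HasDerivAt u' (-f t (u t)) t) →
        ∀ t ∈ Ici t₀, u' t = A + ∫ s in Ioi t, f s (u s) := fun u u' hE hd t ht =>
      eq_add_tail_integral_of_tendsto (hcontf _ _ hE) (hcond _ _ hE).1 hd (hlim0 _ _ hE) ht
    have hiter : ∀ n : ℕ, ∀ t ∈ Ici t₀,
        |y' t - (A + G t)| ≤ ϖ ^ n * (2 * (Mα + Mβ)) * t ^ (-ν) := by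
      intro n
      induction n with
      | zero =>
        intro t ht
        have h1 := hM _ t ht (hyb t ht).1 (hyb t ht).2
        have h2 := hM _ t ht (hx.2.2.2 t ht).1 (hx.2.2.2 t ht).2
        have h3 := abs_sub (y' t - A) (A + G t - A)
        rw [sub_sub_sub_cancel_right] at h3
        linarith
      | succ n ih =>
        intro t ht
        have h := hstep _ _ _ _ _ hx hyE (by positivity) ih t ht
        have h1 := hrep _ _ hyE (fun t ht => (hy t ht).2) t ht
        have h2 := hrep _ _ hx hode t ht
        rw [h1, h2, add_sub_add_left_eq_sub, pow_succ']
        simpa only [mul_assoc] using h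
    have heq : ∀ t ∈ Ici t₀, y' t - (A + G t) = 0 := fun t ht => by
      have h1 : Tendsto (fun n : ℕ => ϖ ^ n * (2 * (Mα + Mβ)) * t ^ (-ν)) atTop (𝓝 0) := by
        simpa using ((tendsto_pow_atTop_nhds_zero_of_lt_one hϖ0 hϖ).mul_const
          (2 * (Mα + Mβ))).mul_const (t ^ (-ν))
      exact abs_nonpos_iff.1 (ge_of_tendsto' h1 fun n => hiter n t ht)
    have hder : ∀ s ∈ Ici t₀, HasDerivAt (fun s => y s - x s) 0 s := fun s hs =>
      ((hyE.1 s hs).sub (hx.1 s hs)).congr_deriv (heq s hs)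
    have := constant_of_has_deriv_right_zero (f := fun s => y s - x s) (b := t)
      (fun r hr => (hder r hr.1).continuousAt.continuousWithinAt)
      (fun r hr => (hder r hr.1).hasDerivWithinAt) t ⟨ht, le_rfl⟩
    simp only [hyE.2.2.1, hx.2.2.1, sub_self] at this
    exact sub_eq_zero.1 this
  · intro hα_top
    refine tendsto_atTop_mono' atTop ?_ (tendsto_atTop_add_const_left atTop (x₀ - A * t₀) hα_top)
    filter_upwards [eventually_ge_atTop t₀] with t ht
    have hGi : IntervalIntegrable (fun s => A + G s - A) volume t₀ t :=
      ((continuous_const.add hGc).sub continuous_const).intervalIntegrable _ _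
    have hαi : IntervalIntegrable α volume t₀ t :=
      (hα_cont.mono (by rw [uIcc_of_le ht]; exact Icc_subset_Ici_self)).intervalIntegrable
    have h1 := intervalIntegral.integral_mono_on ht hαi hGi fun s hs => (hx.2.2.2 s hs.1).1
    rw [intervalIntegral.integral_eq_sub_of_hasDerivAt (f := fun t => x t - A * t)
      (fun s hs => hdiff s (by rw [uIcc_of_le ht] at hs; exact hs.1)) hGi, hx.2.2.1] at h1
    linarith
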